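/- Let l, w be positive integers and i ∈ {1,2}. If Σ = {e₁,…,e_n} ⊆ E^{(i)}_{l,w} is a minpath of the hammock network H^{(i)}_{l,w}, then the set of complementary edges Σ̄ = {ē₁,…,ē_n} is a mincut of the dual network H̄^{(i)}_{l,w}. -/

import Mathlib

open scoped Classical

/-- Parity predicate: kind 1 = even points (x+y even), kind 2 = odd points. -/
def HammockPar (i : ℕ) (p : ℤ × ℤ) : Prop :=
  if i = 1 then Even (p.1 + p.2) else Odd (p.1 + p.2)

/-- The set 𝒱_{l,w} of lattice points of the rectangle [0,l] × [0,w]. -/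
def HammockVAll (l w : ℕ) : Set (ℤ × ℤ) :=
  {p | 0 ≤ p.1 ∧ p.1 ≤ (l : ℤ) ∧ 0 ≤ p.2 ∧ p.2 ≤ (w : ℤ)}

/-- The vertex set V^{(i)}_{l,w} of the hammock network of kind `i`. -/
def HammockV (i l w : ℕ) : Set (ℤ × ℤ) :=
  {p | p ∈ HammockVAll l w ∧ HammockPar i p}

/-- The set 𝓔_{l,w} of all diagonal unit edges inside the rectangle. -/
def HammockEAll (l w : ℕ) : Set (Sym2 (ℤ × ℤ)) :=
  {e | ∃ a b : ℤ × ℤ, e = s(a, b) ∧ a ∈ HammockVAll l w ∧ b ∈ HammockVAll l w ∧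
      |a.1 - b.1| = 1 ∧ |a.2 - b.2| = 1}

/-- The edge set E^{(i)}_{l,w} of the hammock network of kind `i`. -/
def HammockE (i l w : ℕ) : Set (Sym2 (ℤ × ℤ)) :=
  {e | e ∈ HammockEAll l w ∧ ∀ p ∈ e, HammockPar i p}

/-- The allowed steps of an X-path. -/
def XStep : Set (ℤ × ℤ) := {(1, 1), (-1, 1), (1, -1), (-1, -1)}

/-- An X-path: a finite sequence of pairwise distinct lattice points, each obtained
from the previous one by a step in `XStep`. -/
def IsXPath (vs : List (ℤ × ℤ)) : Prop :=
  vs.Nodup ∧ vs.Chain' (fun a b => b - a ∈ XStep)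

/-- The list of edges of an X-path. -/
def xEdges (vs : List (ℤ × ℤ)) : List (Sym2 (ℤ × ℤ)) :=
  (vs.zip vs.tail).map fun q => s(q.1, q.2)

/-- A two-terminal network on the diagonal lattice: an edge set together with
a set of source nodes and a set of terminus nodes. -/
structure HNetwork where
  edges : Set (Sym2 (ℤ × ℤ))
  src : Set (ℤ × ℤ)
  tgt : Set (ℤ × ℤ)

/-- `P` is a pathset: `P ⊆ edges` and `P` contains all edges of some X-path
joining a source node to a terminus node. -/
def HNetwork.IsPathset (N : HNetwork) (P : Set (Sym2 (ℤ × ℤ))) : Prop :=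
  P ⊆ N.edges ∧ ∃ (vs : List (ℤ × ℤ)) (h : vs ≠ []),
    IsXPath vs ∧ vs.head h ∈ N.src ∧ vs.getLast h ∈ N.tgt ∧ ∀ e ∈ xEdges vs, e ∈ P

/-- `C` is a cutset: removing `C` leaves no pathset. -/
def HNetwork.IsCutset (N : HNetwork) (C : Set (Sym2 (ℤ × ℤ))) : Prop :=
  C ⊆ N.edges ∧ ¬ N.IsPathset (N.edges \ C)

/-- A minpath: a pathset no proper subset of which is a pathset. -/
def HNetwork.IsMinpath (N : HNetwork) (P : Set (Sym2 (ℤ × ℤ))) : Prop :=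
  N.IsPathset P ∧ ∀ Q, Q ⊂ P → ¬ N.IsPathset Q

/-- A mincut: a cutset no proper subset of which is a cutset. -/
def HNetwork.IsMincut (N : HNetwork) (C : Set (Sym2 (ℤ × ℤ))) : Prop :=
  N.IsCutset C ∧ ∀ D, D ⊂ C → ¬ N.IsCutset D

/-- The hammock network H^{(i)}_{l,w}: sources are its vertices with x = 0,
terminals its vertices with x = l. -/
def hammock (i l w : ℕ) : HNetwork where
  edges := HammockE i l w
  src := {p | p ∈ HammockV i l w ∧ p.1 = 0}
  tgt := {p | p ∈ HammockV i l w ∧ p.1 = (l : ℤ)}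

/-- The dual network H̄^{(i)}_{l,w}: vertex set 𝒱 − V^{(i)}, edge set 𝓔 − E^{(i)},
sources the points with y = 0, terminals the points with y = w. -/
def hammockDual (i l w : ℕ) : HNetwork where
  edges := HammockEAll l w \ HammockE i l w
  src := {p | p ∈ HammockVAll l w \ HammockV i l w ∧ p.2 = 0}
  tgt := {p | p ∈ HammockVAll l w \ HammockV i l w ∧ p.2 = (w : ℤ)}

/-- The complementary edge: ē of e = {(x,y),(x+1,y±1)} is {(x+1,y),(x,y±1)}. -/
def complEdge : Sym2 (ℤ × ℤ) → Sym2 (ℤ × ℤ) :=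
  Sym2.lift ⟨fun a b => s((a.1, b.2), (b.1, a.2)), fun _ _ => Sym2.eq_swap⟩

/-- The other kind: 2/1 = 2 and 2/2 = 1. -/
def otherKind (i : ℕ) : ℕ := if i = 1 then 2 else 1

/-- The edge set E^{(i)}_{l,w} as a finite set. -/
noncomputable def hammockEFinset (i l w : ℕ) : Finset (Sym2 (ℤ × ℤ)) :=
  ((Finset.Icc (0 : ℤ) l) ×ˢ (Finset.Icc (0 : ℤ) w)).sym2.filter (· ∈ HammockE i l w)

/-- The reliability polynomial h^{(i)}_{l,w}(p) = Σ_P p^{|P|} (1-p)^{lw-|P|},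
summing over all pathsets P of H^{(i)}_{l,w}. -/
noncomputable def hammockRel (i l w : ℕ) (p : ℝ) : ℝ :=
  ∑ P ∈ (hammockEFinset i l w).powerset.filter (fun P : Finset (Sym2 (ℤ × ℤ)) => (hammock i l w).IsPathset ↑P),
    p ^ P.card * (1 - p) ^ (l * w - P.card)

theorem hmk_par {i : ℕ} (hi : i = 1 ∨ i = 2) (p : ℤ × ℤ) :
    HammockPar i p ↔ (p.1 + p.2 + i + 1) % 2 = 0 := by
  rcases hi with rfl | rfl
  · simp only [HammockPar, if_true, Int.even_iff]; push_cast; omega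
  · simp only [HammockPar, Int.odd_iff]
    rw [if_neg (by norm_num)]; push_cast; omega

theorem hmk_memEAll {l w : ℕ} (a b : ℤ × ℤ) : s(a, b) ∈ HammockEAll l w ↔
    a ∈ HammockVAll l w ∧ b ∈ HammockVAll l w ∧ |a.1 - b.1| = 1 ∧ |a.2 - b.2| = 1 := by
  constructor
  · rintro ⟨c, d, h, hc, hd, h1, h2⟩
    rcases Sym2.eq_iff.1 h with ⟨rfl, rfl⟩ | ⟨rfl, rfl⟩
    · exact ⟨hc, hd, h1, h2⟩
    · exact ⟨hd, hc, by rw [abs_sub_comm]; exact h1, by rw [abs_sub_comm]; exact h2⟩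
  · rintro ⟨h1, h2, h3, h4⟩
    exact ⟨a, b, rfl, h1, h2, h3, h4⟩

theorem hmk_memE {i l w : ℕ} (a b : ℤ × ℤ) : s(a, b) ∈ HammockE i l w ↔
    s(a, b) ∈ HammockEAll l w ∧ HammockPar i a ∧ HammockPar i b := by
  constructor
  · intro h
    exact ⟨h.1, h.2 a (Sym2.mem_mk_left a b), h.2 b (Sym2.mem_mk_right a b)⟩
  · rintro ⟨h, ha, hb⟩
    refine ⟨h, fun p hp => ?_⟩
    rcases Sym2.mem_iff.1 hp with rfl | rfl
    · exact ha
    · exact hb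

/-- Arithmetic form of the difference conditions. -/
theorem hmk_abs {x y : ℤ} : |x - y| = 1 ↔ x = y + 1 ∨ y = x + 1 := by
  rw [abs_eq (by norm_num)]; omega

theorem hmk_memDual {i l w : ℕ} (hi : i = 1 ∨ i = 2) (a b : ℤ × ℤ) :
    s(a, b) ∈ (hammockDual i l w).edges ↔
    s(a, b) ∈ HammockEAll l w ∧ ¬ HammockPar i a ∧ ¬ HammockPar i b := by
  have e : (hammockDual i l w).edges = HammockEAll l w \ HammockE i l w := rfl
  rw [e, Set.mem_sdiff, hmk_memE]
  constructor
  · rintro ⟨h1, h2⟩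
    refine ⟨h1, ?_⟩
    have h3 : ¬ (HammockPar i a ∧ HammockPar i b) := fun h => h2 ⟨h1, h⟩
    rw [hmk_memEAll, hmk_abs, hmk_abs] at h1
    rw [hmk_par hi, hmk_par hi] at h3 ⊢
    omega
  · rintro ⟨h1, h2, h3⟩
    exact ⟨h1, fun h => h2 h.2.1⟩

theorem hmk_compl (a b : ℤ × ℤ) : complEdge s(a, b) = s((a.1, b.2), (b.1, a.2)) := rfl

theorem hmk_compl_compl (e : Sym2 (ℤ × ℤ)) : complEdge (complEdge e) = e := by
  induction e with
  | h a b => rfl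

theorem hmk_compl_mem {i l w : ℕ} (hi : i = 1 ∨ i = 2) {e : Sym2 (ℤ × ℤ)}
    (he : e ∈ HammockE i l w) : complEdge e ∈ (hammockDual i l w).edges := by
  induction e with
  | h a b =>
    rw [hmk_compl, hmk_memDual hi]
    rw [hmk_memE] at he
    simp only [hmk_memEAll, hmk_abs, hmk_par hi, HammockVAll, Set.mem_ofPred_eq] at he ⊢
    omega

/-- Walks give X-paths. -/
theorem hmk_path_of_reach (P : Set (Sym2 (ℤ × ℤ)))
    (hP : ∀ a b : ℤ × ℤ, s(a, b) ∈ P → |a.1 - b.1| = 1 ∧ |a.2 - b.2| = 1)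
    {a b : ℤ × ℤ} (h : (SimpleGraph.fromEdgeSet P).Reachable a b) :
    ∃ (vs : List (ℤ × ℤ)) (h : vs ≠ []),
      IsXPath vs ∧ vs.head h = a ∧ vs.getLast h = b ∧ ∀ e ∈ xEdges vs, e ∈ P := by
  obtain ⟨p, hp⟩ := h.exists_isPath
  refine ⟨p.support, p.support_ne_nil, ⟨hp.support_nodup, ?_⟩, by simp, by simp, ?_⟩
  · clear hp
    refine List.IsChain.imp ?_ p.isChain_adj_support
    intro c d hcd
    rw [SimpleGraph.fromEdgeSet_adj] at hcd
    have := hP c d hcd.1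
    rw [hmk_abs, hmk_abs] at this
    obtain ⟨c1, c2⟩ := c
    obtain ⟨d1, d2⟩ := d
    simp only [XStep, Set.mem_insert_iff, Set.mem_singleton_iff, Prod.mk_sub_mk, Prod.mk.injEq]
    simp only at this
    omega
  · clear hp h
    induction p with
    | nil => simp [xEdges]
    | @cons u v w' huv q ih =>
      have : xEdges (SimpleGraph.Walk.cons huv q).support = s(u, v) :: xEdges q.support := by
        cases q <;> simp [xEdges]
      rw [this]
      intro e he
      rcases List.mem_cons.1 he with rfl | he
      · exact ((SimpleGraph.fromEdgeSet_adj _).1 huv).1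
      · exact ih e he

/-! ### Existence half: a parity count over the cells -/

theorem hmk_telescope (V : ℕ → ZMod 2) (n : ℕ) :
    ∑ x ∈ Finset.range n, (V (x + 1) + V x) = V n + V 0 := by
  have h2 : ∀ z : ZMod 2, z + z = 0 := by decide
  induction n with
  | zero => simp [h2]
  | succ n ih => rw [Finset.sum_range_succ, ih]; linear_combination h2 (V n)

theorem hmk_cells (f : ℕ → ℕ → ZMod 2) (l w : ℕ)
    (h0 : ∀ x < l, ∀ y < w, (f (x+1) (y+1) + f x y) * (f (x+1) y + f x (y+1)) = 0) :
    ∑ y ∈ Finset.range w, f l y * f l (y+1) + ∑ y ∈ Finset.range w, f 0 y * f 0 (y+1)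
    + ∑ x ∈ Finset.range l, f x w * f (x+1) w + ∑ x ∈ Finset.range l, f x 0 * f (x+1) 0 = 0 := by
  have h1 : ∑ x ∈ Finset.range l, ∑ y ∈ Finset.range w,
      (f (x+1) (y+1) + f x y) * (f (x+1) y + f x (y+1)) = 0 :=
    Finset.sum_eq_zero fun x hx => Finset.sum_eq_zero fun y hy =>
      h0 x (Finset.mem_range.1 hx) y (Finset.mem_range.1 hy)
  have h2 : ∑ x ∈ Finset.range l, ∑ y ∈ Finset.range w,
      (f (x+1) (y+1) + f x y) * (f (x+1) y + f x (y+1)) =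
      ∑ y ∈ Finset.range w, ∑ x ∈ Finset.range l, (f (x+1) y * f (x+1) (y+1) + f x y * f x (y+1))
      + ∑ x ∈ Finset.range l, ∑ y ∈ Finset.range w,
        (f x (y+1) * f (x+1) (y+1) + f x y * f (x+1) y) := by
    rw [Finset.sum_comm (s := Finset.range w), ← Finset.sum_add_distrib]
    refine Finset.sum_congr rfl fun x _ => ?_
    rw [← Finset.sum_add_distrib]
    exact Finset.sum_congr rfl fun y _ => by ring
  rw [h1] at h2
  have h3 : ∀ y, ∑ x ∈ Finset.range l, (f (x+1) y * f (x+1) (y+1) + f x y * f x (y+1))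
      = f l y * f l (y+1) + f 0 y * f 0 (y+1) := fun y =>
    hmk_telescope (fun x => f x y * f x (y+1)) l
  have h4 : ∀ x, ∑ y ∈ Finset.range w, (f x (y+1) * f (x+1) (y+1) + f x y * f (x+1) y)
      = f x w * f (x+1) w + f x 0 * f (x+1) 0 := fun x =>
    hmk_telescope (fun y => f x y * f (x+1) y) w
  simp only [h3, h4, Finset.sum_add_distrib] at h2
  rw [h2]; ring

theorem hmk_side (q : ℕ → Prop) (g : ℕ → ZMod 2) (n : ℕ) (hq : ∀ k, q (k+1) ↔ ¬ q k)
    (hg : ∀ k ≤ n, q k → g k = 1) :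
    ∑ k ∈ Finset.range n, g k * g (k+1) =
      (if q 0 then 0 else g 0) + (if q n then 0 else g n) := by
  have h2 : ∀ z : ZMod 2, z + z = 0 := by decide
  induction n with
  | zero => simp [h2]
  | succ n ih =>
    rw [Finset.sum_range_succ, ih fun k hk => hg k (by omega)]
    have := hq n
    by_cases hn : q n
    · simp [this, hn, hg n (by omega) hn]
    · have h1 := this.2 hn
      simp only [hn, h1, hg (n+1) le_rfl h1, if_true, if_false]
      linear_combination h2 (g n)

theorem hmk_side_zero (q : ℕ → Prop) (g : ℕ → ZMod 2) (n : ℕ) (hq : ∀ k, q (k+1) ↔ ¬ q k)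
    (hg : ∀ k ≤ n, q k → g k = 0) :
    ∑ k ∈ Finset.range n, g k * g (k+1) = 0 := by
  refine Finset.sum_eq_zero fun k hk => ?_
  rw [Finset.mem_range] at hk
  by_cases h : q k
  · rw [hg k (by omega) h, zero_mul]
  · rw [hg (k+1) (by omega) ((hq k).2 h), mul_zero]

theorem hmk_no_coloring (K : ℕ → ℕ → Prop) (hK1 : ∀ x y, K (x+1) y ↔ ¬ K x y)
    (hK2 : ∀ x y, K x (y+1) ↔ ¬ K x y) (f : ℕ → ℕ → ZMod 2) (l w : ℕ)
    (h0 : ∀ x < l, ∀ y < w, (f (x+1) (y+1) + f x y) * (f (x+1) y + f x (y+1)) = 0)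
    (hL : ∀ y ≤ w, K 0 y → f 0 y = 1) (hR : ∀ y ≤ w, K l y → f l y = 0)
    (hB : ∀ x ≤ l, ¬ K x 0 → f x 0 = 1) (hT : ∀ x ≤ l, ¬ K x w → f x w = 0) : False := by
  have h := hmk_cells f l w h0
  rw [hmk_side_zero (fun y => K l y) (fun y => f l y) w (hK2 l) hR,
    hmk_side (fun y => K 0 y) (fun y => f 0 y) w (hK2 0) hL,
    hmk_side_zero (fun x => ¬ K x w) (fun x => f x w) l (fun x => not_congr (hK1 x w)) hT,
    hmk_side (fun x => ¬ K x 0) (fun x => f x 0) l (fun x => not_congr (hK1 x 0)) hB] at h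
  have e1 : (if K 0 w then 0 else f 0 w) = 0 := by
    split_ifs with hk
    · rfl
    · exact hT 0 (by omega) hk
  simp only [e1] at h
  have hl0 := hR 0 (by omega)
  by_cases hk : K 0 0 <;> by_cases hk' : K l 0
  · simp [hk, hk', hl0 hk', hL 0 (by omega) hk] at h
  · simp [hk, hk', hL 0 (by omega) hk] at h
  · simp [hk, hk', hl0 hk', hB 0 (by omega) hk] at h
  · simp [hk, hk', hB 0 (by omega) hk] at h

theorem hmk_exists {i l w : ℕ} (hi : i = 1 ∨ i = 2) (D : Set (Sym2 (ℤ × ℤ)))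
    (hH : ¬ (hammock i l w).IsPathset {e | e ∈ HammockE i l w ∧ complEdge e ∈ D})
    (hD : ¬ (hammockDual i l w).IsPathset ((hammockDual i l w).edges \ D)) : False := by
  set P : Set (Sym2 (ℤ × ℤ)) := {e | e ∈ HammockE i l w ∧ complEdge e ∈ D} with hPdef
  set Q := (hammockDual i l w).edges \ D with hQdef
  let A : Set (ℤ × ℤ) := {v | ∃ u ∈ (hammock i l w).src, (SimpleGraph.fromEdgeSet P).Reachable u v}
  let B : Set (ℤ × ℤ) :=
    {v | ∃ u ∈ (hammockDual i l w).src, (SimpleGraph.fromEdgeSet Q).Reachable u v}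
  have hAR : ∀ v ∈ A, v ∉ (hammock i l w).tgt := by
    rintro v ⟨u, hu, huv⟩ hv
    obtain ⟨vs, hne, h1, h2, h3, h4⟩ := hmk_path_of_reach P (fun a b hab =>
      ((hmk_memEAll a b).1 hab.1.1).2.2) huv
    exact hH ⟨fun e he => he.1, vs, hne, h1, h2 ▸ hu, h3 ▸ hv, h4⟩
  have hBT : ∀ v ∈ B, v ∉ (hammockDual i l w).tgt := by
    rintro v ⟨u, hu, huv⟩ hv
    obtain ⟨vs, hne, h1, h2, h3, h4⟩ := hmk_path_of_reach Q (fun a b hab =>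
      ((hmk_memEAll a b).1 ((hmk_memDual hi a b).1 hab.1).1).2.2) huv
    exact hD ⟨fun e he => he.1, vs, hne, h1, h2 ▸ hu, h3 ▸ hv, h4⟩
  have hA : ∀ a b, a ≠ b → s(a, b) ∈ P → (a ∈ A ↔ b ∈ A) := by
    intro a b hab h
    have had : (SimpleGraph.fromEdgeSet P).Adj a b := (SimpleGraph.fromEdgeSet_adj _).2 ⟨h, hab⟩
    exact ⟨fun ⟨u, hu, huv⟩ => ⟨u, hu, huv.trans had.reachable⟩,
      fun ⟨u, hu, huv⟩ => ⟨u, hu, huv.trans had.symm.reachable⟩⟩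
  have hB : ∀ a b, a ≠ b → s(a, b) ∈ Q → (a ∈ B ↔ b ∈ B) := by
    intro a b hab h
    have had : (SimpleGraph.fromEdgeSet Q).Adj a b := (SimpleGraph.fromEdgeSet_adj _).2 ⟨h, hab⟩
    exact ⟨fun ⟨u, hu, huv⟩ => ⟨u, hu, huv.trans had.reachable⟩,
      fun ⟨u, hu, huv⟩ => ⟨u, hu, huv.trans had.symm.reachable⟩⟩
  have h2 : ∀ z : ZMod 2, z + z = 0 := by decide
  let F : ℤ × ℤ → ZMod 2 := fun p =>
    if HammockPar i p then (if p ∈ A then 1 else 0) else (if p ∈ B then 1 else 0)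
  have key : ∀ a b : ℤ × ℤ, s(a, b) ∈ HammockE i l w →
      F a + F b = 0 ∨ F (a.1, b.2) + F (b.1, a.2) = 0 := by
    intro a b hab
    have hc := hmk_compl_mem hi hab
    have hab' := (hmk_memE a b).1 hab
    have hne := (hmk_memEAll a b).1 hab'.1
    rw [hmk_abs, hmk_abs] at hne
    by_cases hd : complEdge s(a, b) ∈ D
    · left
      have := hA a b (by rintro rfl; omega) ⟨hab, hd⟩
      simp only [F, hab'.2.1, hab'.2.2, if_true, this, h2]
    · right
      rw [hmk_compl] at hc hd
      have h3 := (hmk_memDual hi _ _).1 hc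
      have := hB (a.1, b.2) (b.1, a.2) (by intro h; rw [Prod.mk.injEq] at h; omega) ⟨hc, hd⟩
      simp only [F, h3.2.1, h3.2.2, if_false, this, h2]
  refine hmk_no_coloring (fun x y => HammockPar i ((x : ℤ), (y : ℤ))) ?_ ?_
    (fun x y => F ((x : ℤ), (y : ℤ))) l w ?_ ?_ ?_ ?_ ?_
  · intro x y; simp only [hmk_par hi]; push_cast; omega
  · intro x y; simp only [hmk_par hi]; push_cast; omega
  · intro x hx y hy
    push_cast
    by_cases hk : HammockPar i ((x : ℤ), (y : ℤ))
    · have := key ((x : ℤ) + 1, (y : ℤ) + 1) ((x : ℤ), (y : ℤ)) (by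
        rw [hmk_memE]
        simp only [hmk_memEAll, hmk_abs, hmk_par hi, HammockVAll, Set.mem_ofPred_eq,
          true_or, or_true, and_true] at hk ⊢
        omega)
      exact mul_eq_zero.2 this
    · have := key ((x : ℤ) + 1, (y : ℤ)) ((x : ℤ), (y : ℤ) + 1) (by
        rw [hmk_memE]
        simp only [hmk_memEAll, hmk_abs, hmk_par hi, HammockVAll, Set.mem_ofPred_eq,
          true_or, or_true, and_true] at hk ⊢
        omega)
      exact mul_eq_zero.2 this.symm
  · intro y hy hk
    have : (((0 : ℕ) : ℤ), (y : ℤ)) ∈ A :=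
      ⟨_, ⟨⟨⟨by simp, by simp, by simp, by simpa using hy⟩, hk⟩, by simp⟩,
        SimpleGraph.Reachable.refl _⟩
    simp only [F]
    rw [if_pos hk, if_pos this]
  · intro y hy hk
    have : ((l : ℤ), (y : ℤ)) ∉ A := fun h => hAR _ h
      ⟨⟨⟨by simp, by simp, by simp, by simpa using hy⟩, hk⟩, by simp⟩
    simp only [F]
    rw [if_pos hk, if_neg this]
  · intro x hx hk
    have : ((x : ℤ), ((0 : ℕ) : ℤ)) ∈ B :=
      ⟨_, ⟨⟨⟨by simp, by simpa using hx, by simp, by simp⟩, fun h => hk h.2⟩, by simp⟩,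
        SimpleGraph.Reachable.refl _⟩
    simp only [F]
    rw [if_neg hk, if_pos this]
  · intro x hx hk
    have : ((x : ℤ), (w : ℤ)) ∉ B := fun h => hBT _ h
      ⟨⟨⟨by simp, by simpa using hx, by simp, by simp⟩, fun h => hk h.2⟩, by simp⟩
    simp only [F]
    rw [if_neg hk, if_neg this]

/-! ### Crossing half: crossing numbers of a dual path with leftward rays -/

/-- Whether the dual step `c d` crosses the leftward ray just above `a`. -/
noncomputable def hmkG (a c d : ℤ × ℤ) : ZMod 2 :=
  if min c.2 d.2 = a.2 ∧ min c.1 d.1 < a.1 then 1 else 0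

/-- Whether `c` lies strictly to the left of `b` at the same height. -/
noncomputable def hmkT (b c : ℤ × ℤ) : ZMod 2 :=
  if c.2 = b.2 ∧ c.1 < b.1 then 1 else 0

/-- Sum of a function over consecutive pairs of a list. -/
def hmkSum (F : ℤ × ℤ → ℤ × ℤ → ZMod 2) : List (ℤ × ℤ) → ZMod 2
  | [] => 0
  | [_] => 0
  | a :: b :: t => F a b + hmkSum F (b :: t)

theorem hmkSum_telescope (F : ℤ × ℤ → ℤ × ℤ → ZMod 2) (t : ℤ × ℤ → ZMod 2) :
    ∀ (us : List (ℤ × ℤ)) (h : us ≠ []),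
      (∀ c d, s(c, d) ∈ xEdges us → F c d = t c + t d) →
      hmkSum F us = t (us.head h) + t (us.getLast h)
  | [], h, _ => absurd rfl h
  | [a], _, _ => by
    have h2 : ∀ z : ZMod 2, z + z = 0 := by decide
    simp [hmkSum, h2]
  | a :: b :: r, _, hF => by
    have h2 : ∀ z : ZMod 2, z + z = 0 := by decide
    have e : xEdges (a :: b :: r) = s(a, b) :: xEdges (b :: r) := rfl
    have ih := hmkSum_telescope F t (b :: r) (by simp)
      (fun c d hcd => hF c d (by rw [e]; exact List.mem_cons_of_mem _ hcd))
    have h1 := hF a b (by rw [e]; exact List.mem_cons_self)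
    have e2 : hmkSum F (a :: b :: r) = F a b + hmkSum F (b :: r) := rfl
    rw [e2, ih, h1]
    simp only [List.head_cons, List.getLast_cons_cons]
    linear_combination h2 (t b)

theorem hmkSum_add (F F' : ℤ × ℤ → ℤ × ℤ → ZMod 2) :
    ∀ us : List (ℤ × ℤ), hmkSum (fun c d => F c d + F' c d) us = hmkSum F us + hmkSum F' us
  | [] => by simp [hmkSum]
  | [a] => by simp [hmkSum]
  | a :: b :: r => by
    have ih := hmkSum_add F F' (b :: r)
    simp only [hmkSum] at ih ⊢
    rw [ih]; ring

set_option maxHeartbeats 4000000 in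
theorem hmk_local {i : ℕ} (hi : i = 1 ∨ i = 2) (a b c d : ℤ × ℤ)
    (ha : HammockPar i a) (hb : HammockPar i b) (hc : ¬ HammockPar i c) (hd : ¬ HammockPar i d)
    (hab : b.2 = a.2 + 1) (hab1 : |a.1 - b.1| = 1) (h1 : |c.1 - d.1| = 1) (h2 : |c.2 - d.2| = 1)
    (hne : s(c, d) ≠ complEdge s(a, b)) :
    hmkG a c d + hmkG b c d = hmkT b c + hmkT b d := by
  obtain ⟨a1, a2⟩ := a
  obtain ⟨b1, b2⟩ := b
  obtain ⟨c1, c2⟩ := c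
  obtain ⟨d1, d2⟩ := d
  rw [hmk_compl, Ne, Sym2.eq_iff] at hne
  simp only [hmk_par hi, hmk_abs, hmkG, hmkT, Prod.mk.injEq] at *
  subst hab
  have m1 : ∀ x : ℤ, min (x + 1) x = x := fun x => by omega
  have m2 : ∀ x : ℤ, min x (x + 1) = x := fun x => by omega
  have h11 : (1 : ZMod 2) + 1 = 0 := by decide
  rcases h1 with h1 | h1 <;> rcases h2 with h2 | h2 <;> subst h1 <;> subst h2 <;>
  simp only [m1, m2] <;>
  split_ifs <;> first | rfl | (exfalso; omega) | simp [h11]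

theorem hmk_cross {i l w : ℕ} (hi : i = 1 ∨ i = 2) (S : Set (Sym2 (ℤ × ℤ)))
    (hH : (hammock i l w).IsPathset S)
    (hD : (hammockDual i l w).IsPathset ((hammockDual i l w).edges \ complEdge '' S)) : False := by
  obtain ⟨hS, vs, hv, -, hvs, hvt, hve⟩ := hH
  obtain ⟨-, us, hu, -, hus, hut, hue⟩ := hD
  set o := us.getLast hu with ho
  have hfact : ∀ c d, s(c, d) ∈ xEdges us →
      (c ∈ HammockVAll l w ∧ d ∈ HammockVAll l w ∧ |c.1 - d.1| = 1 ∧ |c.2 - d.2| = 1) ∧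
      ¬ HammockPar i c ∧ ¬ HammockPar i d := by
    intro c d h
    have := (hmk_memDual hi c d).1 (hue _ h).1
    rwa [hmk_memEAll] at this
  have hoV : o ∈ HammockVAll l w := hut.1.1
  have hoK : ¬ HammockPar i o := fun h => hut.1.2 ⟨hoV, h⟩
  have how : o.2 = w := hut.2
  have hs0 : (us.head hu).2 = 0 := hus.2
  have h2 : ∀ z : ZMod 2, z + z = 0 := by decide
  let g : ℤ × ℤ → ZMod 2 := fun a => hmkSum (hmkG a) us + hmkT a o
  -- an upward step does not change `g`
  have hstep : ∀ a b, s(a, b) ∈ S → b.2 = a.2 + 1 → g a = g b := by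
    intro a b hab hb
    have hE := (hmk_memE a b).1 (hS hab)
    have hE1 := (hmk_memEAll a b).1 hE.1
    have h := hmkSum_telescope (fun c d => hmkG a c d + hmkG b c d) (hmkT b) us hu (by
      intro c d hcd
      have hf := hfact c d hcd
      exact hmk_local hi a b c d hE.2.1 hE.2.2 hf.2.1 hf.2.2 hb hE1.2.2.1 hf.1.2.2.1 hf.1.2.2.2
        (fun he => (hue _ hcd).2 ⟨_, hab, he.symm⟩))
    rw [hmkSum_add (hmkG a) (hmkG b)] at h
    obtain ⟨⟨a1, a2, a3, a4⟩, ⟨b1, b2, b3, b4⟩, -, -⟩ := hE1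
    have t1 : hmkT b (us.head hu) = 0 := by
      rw [hmkT, if_neg]; omega
    have t2 : hmkT a o = 0 := by
      rw [hmkT, if_neg]; omega
    rw [t1, ← ho, zero_add] at h
    simp only [g, t2]
    linear_combination h - h2 (hmkSum (hmkG b) us)
  have hstep' : ∀ a b, s(a, b) ∈ S → g a = g b := by
    intro a b hab
    have hE1 := (hmk_memEAll a b).1 ((hmk_memE a b).1 (hS hab)).1
    rcases hmk_abs.1 hE1.2.2.2 with h | h
    · exact (hstep b a (by rwa [Sym2.eq_swap]) h).symm
    · exact hstep a b hab h
  have hconst : ∀ (r : List (ℤ × ℤ)) (hr : r ≠ []), (∀ e ∈ xEdges r, e ∈ S) →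
      g (r.head hr) = g (r.getLast hr) := by
    intro r
    induction r with
    | nil => intro hr; exact absurd rfl hr
    | cons a r ih =>
      intro _ hr
      cases r with
      | nil => rfl
      | cons b r =>
        have e : xEdges (a :: b :: r) = s(a, b) :: xEdges (b :: r) := rfl
        rw [e] at hr
        have := ih (by simp) (fun e he => hr e (List.mem_cons_of_mem _ he))
        rw [List.getLast_cons_cons, ← this]
        exact hstep' a b (hr _ List.mem_cons_self)
  have hfin := hconst vs hv hve
  have hleft : g (vs.head hv) = 0 := by
    have hx : (vs.head hv).1 = 0 := hvs.2
    have h := hmkSum_telescope (hmkG (vs.head hv)) (fun _ => 0) us hu (by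
      intro c d hcd
      obtain ⟨⟨⟨c1, c2, c3, c4⟩, ⟨d1, d2, d3, d4⟩, -, -⟩, -, -⟩ := hfact c d hcd
      rw [hmkG, if_neg, add_zero]
      omega)
    have t : hmkT (vs.head hv) o = 0 := by
      obtain ⟨o1, -⟩ := hoV
      rw [hmkT, if_neg]; omega
    simp only [g, h, t, add_zero]
  have hright : g (vs.getLast hv) = 1 := by
    have hx : (vs.getLast hv).1 = l := hvt.2
    have hK : HammockPar i (vs.getLast hv) := hvt.1.2
    obtain ⟨q1, q2, q3, q4⟩ := hvt.1.1
    set q := vs.getLast hv with hq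
    have h := hmkSum_telescope (hmkG q) (fun c => if c.2 ≤ q.2 then 1 else 0) us hu (by
      intro c d hcd
      obtain ⟨⟨⟨c1, c2, c3, c4⟩, ⟨d1, d2, d3, d4⟩, e1, e2⟩, -, -⟩ := hfact c d hcd
      rw [hmk_abs] at e1 e2
      have h11 : (1 : ZMod 2) + 1 = 0 := by decide
      simp only [hmkG]
      split_ifs <;> first | (exfalso; omega) | simp [h11])
    obtain ⟨o1, o2, o3, o4⟩ := hoV
    rw [hmk_par hi] at hK hoK
    have h11 : (1 : ZMod 2) + 1 = 0 := by decide
    simp only [g, h, hmkT, ← ho]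
    rw [if_pos (by omega)]
    split_ifs <;> first | (exfalso; omega) | simp [add_assoc, h11]
  rw [hleft, hright] at hfin
  exact absurd hfin (by decide)

/-- If Σ ⊆ E^{(i)}_{l,w} is a minpath of the hammock network H^{(i)}_{l,w},
then the set of complementary edges Σ̄ is a mincut of the dual network H̄^{(i)}_{l,w}. -/
theorem minpath_compl_isMincut_dual (l w : ℕ) (hl : 0 < l) (hw : 0 < w)
    (i : ℕ) (hi : i = 1 ∨ i = 2) (S : Set (Sym2 (ℤ × ℤ)))
    (hSE : S ⊆ HammockE i l w) (hS : (hammock i l w).IsMinpath S) :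
    (hammockDual i l w).IsMincut (complEdge '' S) := by
  refine ⟨⟨?_, fun h => hmk_cross hi S hS.1 h⟩, ?_⟩
  · rintro _ ⟨e, he, rfl⟩
    exact hmk_compl_mem hi (hSE he)
  · intro D hD hcut
    refine hmk_exists hi D (hS.2 _ ?_) hcut.2
    refine ⟨?_, ?_⟩
    · rintro e ⟨-, he⟩
      obtain ⟨e', he', h⟩ := hD.1 he
      have := congrArg complEdge h
      rw [hmk_compl_compl, hmk_compl_compl] at this
      exact this ▸ he'
    · intro hsub
      apply hD.2
      rintro _ ⟨e, he, rfl⟩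
      exact (hsub he).2
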